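/- Under the setting of the previous result (x̃ solves dx̃/dλ = F(λ)x̃ on [0,1] with x̃(0)=x̃₀, M(λ) = -((α+β)A₀ + βA_h) invertible, and F defined from M, A_h, Q as stated), assume additionally that there exists a constant symmetric positive definite n×n matrix M₀ with M(λ) ≥ M₀ in the Loewner order for all λ ∈ [0,1], and that Q(λ) is positive semidefinite for all λ. Then x̃(λ)ᵀ M₀ x̃(λ) ≤ c for all λ ∈ [0,1], where c = x̃₀ᵀ M(0) x̃₀ = -x̃₀ᵀ A₀ x̃₀. -/

import Mathlib

open Matrix Set

theorem HasDerivWithinAt.dotProduct {ι : Type*} [Fintype ι] {u v : ℝ → ι → ℝ} {u' v' : ι → ℝ}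
    {s : Set ℝ} {t : ℝ} (hu : HasDerivWithinAt u u' s t) (hv : HasDerivWithinAt v v' s t) :
    HasDerivWithinAt (fun r => u r ⬝ᵥ v r) (u' ⬝ᵥ v t + u t ⬝ᵥ v') s t := by
  rw [hasDerivWithinAt_pi] at hu hv
  simp only [_root_.dotProduct, ← Finset.sum_add_distrib]
  exact HasDerivWithinAt.fun_sum fun i _ => (hu i).mul (hv i)

theorem HasDerivWithinAt.const_mulVec {ι κ : Type*} [Fintype ι] [Fintype κ]
    (A : Matrix κ ι ℝ) {v : ℝ → ι → ℝ} {v' : ι → ℝ} {s : Set ℝ} {t : ℝ}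
    (hv : HasDerivWithinAt v v' s t) :
    HasDerivWithinAt (fun r => A *ᵥ v r) (A *ᵥ v') s t := by
  rw [hasDerivWithinAt_pi]
  intro i
  simpa [mulVec] using (hasDerivWithinAt_const t s (A i)).dotProduct hv

theorem Matrix.IsSymm.dotProduct_mulVec_comm {ι : Type*} [Fintype ι] {A : Matrix ι ι ℝ}
    (hA : A.IsSymm) (x y : ι → ℝ) : x ⬝ᵥ A *ᵥ y = y ⬝ᵥ A *ᵥ x := by
  rw [dotProduct_mulVec, ← mulVec_transpose, hA.eq, dotProduct_comm]

theorem HasDerivWithinAt.quadraticForm {ι : Type*} [Fintype ι] {A : Matrix ι ι ℝ}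
    (hA : A.IsSymm) {x : ℝ → ι → ℝ} {x' : ι → ℝ} {s : Set ℝ} {t : ℝ}
    (hx : HasDerivWithinAt x x' s t) :
    HasDerivWithinAt (fun r => x r ⬝ᵥ A *ᵥ x r) (2 * (x t ⬝ᵥ A *ᵥ x')) s t := by
  convert hx.dotProduct (hx.const_mulVec A) using 1
  rw [hA.dotProduct_mulVec_comm x' (x t), two_mul]

/-- Paper's Theorem 2.3, part (1): under the setting of Lemma 2.2, if there is
a constant symmetric positive definite `M₀` with `M(λ) ≥ M₀` (Loewner order)
for all `λ ∈ [0,1]` and `Q(λ)` is positive semidefinite, then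
`x̃(λ)ᵀ M₀ x̃(λ) ≤ c` on `[0,1]`, where `c = x̃₀ᵀ M(0) x̃₀ = -x̃₀ᵀ A₀ x̃₀`. -/
theorem particle_flow_difference_bounded
    {n : ℕ} (α β α' β' : ℝ → ℝ)
    (hα : ∀ l ∈ Icc (0:ℝ) 1, HasDerivWithinAt α (α' l) (Icc (0:ℝ) 1) l)
    (hβ : ∀ l ∈ Icc (0:ℝ) 1, HasDerivWithinAt β (β' l) (Icc (0:ℝ) 1) l)
    (hα' : ContinuousOn α' (Icc (0:ℝ) 1))
    (hβ' : ContinuousOn β' (Icc (0:ℝ) 1))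
    (hα0 : α 0 = 1) (hβ0 : β 0 = 0)
    (hαβ : ∀ l ∈ Icc (0:ℝ) 1, α l + β l ≠ 0)
    (A₀ Ah : Matrix (Fin n) (Fin n) ℝ)
    (hA₀ : A₀.IsSymm) (hAh : Ah.IsSymm)
    (M : ℝ → Matrix (Fin n) (Fin n) ℝ)
    (hM : ∀ l, M l = -((α l + β l) • A₀ + β l • Ah))
    (hMinv : ∀ l ∈ Icc (0:ℝ) 1, IsUnit (M l))
    (Q : ℝ → Matrix (Fin n) (Fin n) ℝ)
    (hQ : ∀ l, (Q l).IsSymm)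
    (hQcont : ContinuousOn Q (Icc (0:ℝ) 1))
    (hQpsd : ∀ l ∈ Icc (0:ℝ) 1, (Q l).PosSemidef)
    (F : ℝ → Matrix (Fin n) (Fin n) ℝ)
    (hF : ∀ l, F l = -((1:ℝ)/2) • (Q l * M l)
      + ((α l * β' l - α' l * β l) / (2 * (α l + β l))) • ((M l)⁻¹ * Ah)
      - ((α' l + β' l) / (2 * (α l + β l))) • (1 : Matrix (Fin n) (Fin n) ℝ))
    (M₀ : Matrix (Fin n) (Fin n) ℝ) (hM₀ : M₀.PosDef)
    (hMge : ∀ l ∈ Icc (0:ℝ) 1, (M l - M₀).PosSemidef)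
    (xt : ℝ → (Fin n → ℝ)) (xt₀ : Fin n → ℝ)
    (hxt0 : xt 0 = xt₀)
    (hxt : ∀ l ∈ Icc (0:ℝ) 1,
      HasDerivWithinAt xt ((F l).mulVec (xt l)) (Icc (0:ℝ) 1) l) :
    (∀ l ∈ Icc (0:ℝ) 1,
      xt l ⬝ᵥ M₀.mulVec (xt l) ≤ xt₀ ⬝ᵥ (M 0).mulVec xt₀) ∧
    xt₀ ⬝ᵥ (M 0).mulVec xt₀ = -(xt₀ ⬝ᵥ A₀.mulVec xt₀) := by
  have quad (l : ℝ) (x y : Fin n → ℝ) :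
      x ⬝ᵥ M l *ᵥ y = -((α l + β l) * (x ⬝ᵥ A₀ *ᵥ y) + β l * (x ⬝ᵥ Ah *ᵥ y)) := by
    simp [hM l, neg_mulVec, add_mulVec, smul_mulVec]
  have symm (l : ℝ) : (M l).IsSymm := by
    rw [hM l]
    exact ((hA₀.smul _).add (hAh.smul _)).neg
  have deriv_energy (l : ℝ) (hl : l ∈ Icc (0:ℝ) 1) :
      HasDerivWithinAt (fun r => xt r ⬝ᵥ M r *ᵥ xt r)
        (-((M l *ᵥ xt l) ⬝ᵥ Q l *ᵥ (M l *ᵥ xt l))) (Icc (0:ℝ) 1) l := by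
    have drift : xt l ⬝ᵥ M l *ᵥ (F l *ᵥ xt l)
        = -(1 / 2) * ((M l *ᵥ xt l) ⬝ᵥ Q l *ᵥ (M l *ᵥ xt l))
          + (α l * β' l - α' l * β l) / (2 * (α l + β l)) * (xt l ⬝ᵥ Ah *ᵥ xt l)
          - (α' l + β' l) / (2 * (α l + β l)) * (xt l ⬝ᵥ M l *ᵥ xt l) := by
      have hcancel : M l * ((M l)⁻¹ * Ah) = Ah :=
        mul_nonsing_inv_cancel_left _ _ ((isUnit_iff_isUnit_det _).1 (hMinv l hl))
      have hquad : xt l ⬝ᵥ M l *ᵥ (Q l *ᵥ (M l *ᵥ xt l))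
          = (M l *ᵥ xt l) ⬝ᵥ Q l *ᵥ (M l *ᵥ xt l) := by
        rw [(symm l).dotProduct_mulVec_comm, dotProduct_comm]
      rw [← hquad, mulVec_mulVec, hF l, mul_sub, mul_add, Matrix.mul_smul, Matrix.mul_smul,
        Matrix.mul_smul, hcancel, mul_one]
      simp only [sub_mulVec, add_mulVec, smul_mulVec, dotProduct_sub, dotProduct_add,
        dotProduct_smul, smul_eq_mul, mulVec_mulVec]
    simp only [quad _ (xt _) (xt _)]
    refine ((((hα l hl).add (hβ l hl)).mul ((hxt l hl).quadraticForm hA₀)).add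
      ((hβ l hl).mul ((hxt l hl).quadraticForm hAh))).neg.congr_deriv ?_
    rw [quad, quad] at drift
    have h := hαβ l hl
    field_simp at drift
    simp only [Pi.add_apply]
    apply mul_left_cancel₀ h
    linear_combination drift
  have energy_antitone : AntitoneOn (fun r => xt r ⬝ᵥ M r *ᵥ xt r) (Icc (0:ℝ) 1) :=
    antitoneOn_of_hasDerivWithinAt_nonpos (convex_Icc 0 1)
      (fun l hl => (deriv_energy l hl).continuousWithinAt)
      (fun l hl => (deriv_energy l (interior_subset hl)).mono interior_subset)
      fun l hl => neg_nonpos.2 <| by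
        simpa using (hQpsd l (interior_subset hl)).dotProduct_mulVec_nonneg (M l *ᵥ xt l)
  refine ⟨fun l hl => ?_, by simp [quad, hα0, hβ0]⟩
  have hle : xt l ⬝ᵥ M l *ᵥ xt l ≤ xt 0 ⬝ᵥ M 0 *ᵥ xt 0 :=
    energy_antitone (left_mem_Icc.2 zero_le_one) hl hl.1
  have hge := (hMge l hl).dotProduct_mulVec_nonneg (xt l)
  simp only [star_trivial, sub_mulVec, dotProduct_sub] at hge
  rw [hxt0] at hle
  linarith
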